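/- Let D ⊂ ℝ² be a bounded open set and ε > 0. Let u : cl(D) → ℝ be continuous with u = 0 on ∂D and −1 < u(x) ≤ 0 for all x ∈ D, and assume u is twice differentiable in D with Δu(x) ≥ 0 for all x ∈ D. Set Ω(u) := { (x,z) ∈ D × ℝ : −1 < z < u(x) } and M(x,z) := 1 + z − u(x). Let ψ : cl(Ω(u)) → ℝ be continuous, twice differentiable in Ω(u), satisfy ε²·(∂²_{x₁}ψ + ∂²_{x₂}ψ) + ∂²_z ψ = 0 at every point of Ω(u), and satisfy ψ(x,z) = (1+z)/(1+u(x)) for every (x,z) ∈ ∂Ω(u). Then: (i) ψ(x,z) ≤ M(x,z) for all (x,z) ∈ Ω(u); and (ii) for every x ∈ D at which the function z ↦ ψ(x,z) has a (left) derivative at z = u(x) within (−1, u(x)], this derivative satisfies ∂_z ψ(x, u(x)) ≥ 1. -/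

import Mathlib

/-- First partial derivative of a function on `ℝ² × ℝ` in direction `e`. -/
noncomputable def pdir (e : (ℝ × ℝ) × ℝ) (f : (ℝ × ℝ) × ℝ → ℝ)
    (p : (ℝ × ℝ) × ℝ) : ℝ := fderiv ℝ f p e

/-- Second partial derivative of a function on `ℝ² × ℝ` in direction `e`. -/
noncomputable def pdir2 (e : (ℝ × ℝ) × ℝ) (f : (ℝ × ℝ) × ℝ → ℝ) :
    (ℝ × ℝ) × ℝ → ℝ := pdir e (pdir e f)

/-- The dimensionless region between the ground plate at `z = -1` and the
elastic plate given by the graph of the deflection `u`. -/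
def plateRegion (D : Set (ℝ × ℝ)) (u : ℝ × ℝ → ℝ) : Set ((ℝ × ℝ) × ℝ) :=
  {p : (ℝ × ℝ) × ℝ | p.1 ∈ D ∧ -1 < p.2 ∧ p.2 < u p.1}

open Filter Topology Set

/-- Second-order necessary condition for a local maximum on the line. -/
theorem IsLocalMax.second_deriv_nonpos {g g' : ℝ → ℝ} {a c : ℝ} (hmax : IsLocalMax g a)
    (hg : ∀ᶠ t in 𝓝 a, HasDerivAt g (g' t) t) (hg' : HasDerivAt g' c a) : c ≤ 0 := by
  by_contra! hc
  have hderiv : deriv g =ᶠ[𝓝 a] g' := hg.mono fun t ht => ht.deriv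
  have hc' : deriv (deriv g) a = c := hderiv.deriv_eq.trans hg'.deriv
  have hmin : IsLocalMin g a :=
    isLocalMin_of_deriv_deriv_pos (hc'.symm ▸ hc) hmax.deriv_eq_zero
      hg.self_of_nhds.continuousAt
  have hconst : g =ᶠ[𝓝 a] fun _ => g a := by
    filter_upwards [hmax, hmin] with t h₁ h₂ using le_antisymm h₁ h₂
  have h₀ : deriv g =ᶠ[𝓝 a] fun _ => 0 := by
    simpa using hconst.deriv
  have : deriv (deriv g) a = 0 := by simpa using h₀.deriv_eq
  linarith

/-- Second-order necessary condition in the direction `e` for a local maximum of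
`ψ - M + δ z²`, where `M(x,z) = 1 + z - u(x)`. -/
theorem pdir2_add_le_of_isLocalMax {ψ : (ℝ × ℝ) × ℝ → ℝ} {u : ℝ × ℝ → ℝ} {δ : ℝ}
    {q e : (ℝ × ℝ) × ℝ}
    (hmax : IsLocalMax (fun p => ψ p - (1 + p.2 - u p.1) + δ * p.2 ^ 2) q)
    (hψ : ∀ᶠ p in 𝓝 q, DifferentiableAt ℝ ψ p)
    (hψ' : DifferentiableAt ℝ (pdir e ψ) q)
    (hu : ∀ᶠ x in 𝓝 q.1, DifferentiableAt ℝ u x)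
    (hu' : DifferentiableAt ℝ (fun y => fderiv ℝ u y e.1) q.1) :
    pdir2 e ψ q + fderiv ℝ (fun y => fderiv ℝ u y e.1) q.1 e.1 + 2 * δ * e.2 ^ 2 ≤ 0 := by
  have hline : ∀ t : ℝ, HasDerivAt (fun t : ℝ => q + t • e) e t := fun t => by
    simpa using ((hasDerivAt_id t).smul_const e).const_add q
  have hline₁ : ∀ t : ℝ, HasDerivAt (fun t : ℝ => q.1 + t • e.1) e.1 t := fun t => by
    simpa using ((hasDerivAt_id t).smul_const e.1).const_add q.1
  have hline₂ : ∀ t : ℝ, HasDerivAt (fun t : ℝ => q.2 + t * e.2) e.2 t := fun t => by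
    simpa using ((hasDerivAt_id t).mul_const e.2).const_add q.2
  have htend : Tendsto (fun t : ℝ => q + t • e) (𝓝 0) (𝓝 q) := by
    simpa [ContinuousAt] using (hline 0).continuousAt
  have htend₁ : Tendsto (fun t : ℝ => q.1 + t • e.1) (𝓝 0) (𝓝 q.1) := by
    simpa [ContinuousAt] using (hline₁ 0).continuousAt
  have hmax' : IsLocalMax (fun t : ℝ => ψ (q + t • e)
      - (1 + (q.2 + t * e.2) - u (q.1 + t • e.1)) + δ * (q.2 + t * e.2) ^ 2) 0 := by
    filter_upwards [htend.eventually hmax] with t ht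
    simpa using ht
  refine hmax'.second_deriv_nonpos (g' := fun t => pdir e ψ (q + t • e)
      - (e.2 - fderiv ℝ u (q.1 + t • e.1) e.1) + δ * (2 * (q.2 + t * e.2) * e.2)) ?_ ?_
  · filter_upwards [htend.eventually hψ, htend₁.eventually hu] with t h₁ h₂
    have hd₁ := h₁.hasFDerivAt.comp_hasDerivAt t (hline t)
    have hd₂ := h₂.hasFDerivAt.comp_hasDerivAt t (hline₁ t)
    have hd₃ := ((hline₂ t).pow 2).const_mul δ
    refine ((hd₁.sub (((hline₂ t).const_add 1).sub hd₂)).add hd₃).congr_deriv ?_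
    simp [pdir]
  · have hq : q + (0 : ℝ) • e = q := by simp
    have hq₁ : q.1 + (0 : ℝ) • e.1 = q.1 := by simp
    have hd₁ := (hq.symm ▸ hψ'.hasFDerivAt :
      HasFDerivAt (pdir e ψ) (fderiv ℝ (pdir e ψ) q) (q + (0 : ℝ) • e)).comp_hasDerivAt 0 (hline 0)
    have hd₂ := (hq₁.symm ▸ hu'.hasFDerivAt : HasFDerivAt (fun y => fderiv ℝ u y e.1)
      (fderiv ℝ (fun y => fderiv ℝ u y e.1) q.1) (q.1 + (0 : ℝ) • e.1)).comp_hasDerivAt 0 (hline₁ 0)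
    have hd₃ := (((hline₂ 0).const_mul 2).mul_const e.2).const_mul δ
    refine ((hd₁.sub (hd₂.const_sub e.2)).add hd₃).congr_deriv ?_
    simp only [pdir2, pdir]
    ring

theorem isOpen_plateRegion {D : Set (ℝ × ℝ)} {u : ℝ × ℝ → ℝ} (hD : IsOpen D)
    (hu : ContinuousOn u D) : IsOpen (plateRegion D u) := by
  rw [isOpen_iff_eventually]
  rintro p ⟨hp, h₁, h₂⟩
  have hc : ContinuousAt (fun p : (ℝ × ℝ) × ℝ => u p.1) p :=
    (hu.continuousAt (hD.mem_nhds hp)).comp continuousAt_fst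
  filter_upwards [continuousAt_fst.eventually (hD.mem_nhds hp),
    continuousAt_snd.eventually (lt_mem_nhds h₁), continuousAt_snd.eventually_lt hc h₂]
    with p' a b c using ⟨a, b, c⟩

theorem fst_mem_closure_of_mem_closure_plateRegion {D : Set (ℝ × ℝ)} {u : ℝ × ℝ → ℝ}
    {p : (ℝ × ℝ) × ℝ} (hp : p ∈ closure (plateRegion D u)) : p.1 ∈ closure D :=
  (show MapsTo Prod.fst (plateRegion D u) D from fun _ h => h.1).closure continuous_fst hp

theorem bounds_of_mem_closure_plateRegion {D : Set (ℝ × ℝ)} {u : ℝ × ℝ → ℝ}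
    (hu : ContinuousOn u (closure D)) {p : (ℝ × ℝ) × ℝ}
    (hp : p ∈ closure (plateRegion D u)) : -1 ≤ p.2 ∧ p.2 ≤ u p.1 :=
  ⟨le_on_closure (fun _ h => h.2.1.le) continuousOn_const continuousOn_snd hp,
    le_on_closure (fun _ h => h.2.2.le) continuousOn_snd
      (hu.comp continuousOn_fst fun _ h => fst_mem_closure_of_mem_closure_plateRegion h) hp⟩

theorem mk_mem_frontier_plateRegion {D : Set (ℝ × ℝ)} {u : ℝ × ℝ → ℝ} {x : ℝ × ℝ}
    (hx : x ∈ D) (hux : -1 < u x) : (x, u x) ∈ frontier (plateRegion D u) := by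
  refine ⟨?_, fun h => lt_irrefl _ (interior_subset h).2.2⟩
  refine (show MapsTo (fun z => (x, z)) (Ioo (-1) (u x)) (plateRegion D u) from
    fun z hz => ⟨hx, hz⟩).closure (by fun_prop) ?_
  rw [closure_Ioo hux.ne]
  exact right_mem_Icc.2 hux.le

theorem isBounded_plateRegion {D : Set (ℝ × ℝ)} {u : ℝ × ℝ → ℝ} (hD : Bornology.IsBounded D)
    (hu : ∀ x ∈ D, u x ≤ 0) : Bornology.IsBounded (plateRegion D u) :=
  (hD.prod (Metric.isBounded_Icc (-1 : ℝ) 0)).subset fun _ hp =>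
    ⟨hp.1, hp.2.1.le, hp.2.2.le.trans (hu _ hp.1)⟩

/-- Comparison lemma: the electrostatic potential `ψ` is dominated by the
supersolution `M(x,z) = 1 + z − u(x)` in `Ω(u)`, and consequently the vertical
(left) derivative of `ψ` on the elastic plate is at least `1`. -/
theorem potential_comparison_and_lower_bound
    (D : Set (ℝ × ℝ)) (hDopen : IsOpen D) (hDbdd : Bornology.IsBounded D)
    (ε : ℝ) (hε : 0 < ε)
    (u : ℝ × ℝ → ℝ)
    (hucont : ContinuousOn u (closure D))
    (hubc : ∀ x ∈ frontier D, u x = 0)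
    (hurange : ∀ x ∈ D, -1 < u x ∧ u x ≤ 0)
    -- `u` is twice differentiable in `D` with `Δu ≥ 0`
    (hudiff : ∀ x ∈ D, DifferentiableAt ℝ u x)
    (hudiff1 : ∀ x ∈ D, DifferentiableAt ℝ (fun y => fderiv ℝ u y (1, 0)) x)
    (hudiff2 : ∀ x ∈ D, DifferentiableAt ℝ (fun y => fderiv ℝ u y (0, 1)) x)
    (hulap : ∀ x ∈ D, 0 ≤ fderiv ℝ (fun y => fderiv ℝ u y (1, 0)) x (1, 0)
        + fderiv ℝ (fun y => fderiv ℝ u y (0, 1)) x (0, 1))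
    (ψ : (ℝ × ℝ) × ℝ → ℝ)
    (hψcont : ContinuousOn ψ (closure (plateRegion D u)))
    -- `ψ` is twice differentiable in `Ω(u)`
    (hψdiff : ∀ p ∈ plateRegion D u, DifferentiableAt ℝ ψ p)
    (hψdiff2 : ∀ e : (ℝ × ℝ) × ℝ, ∀ p ∈ plateRegion D u,
      DifferentiableAt ℝ (pdir e ψ) p)
    -- the rescaled Laplace equation `ε²Δ′ψ + ∂²_zψ = 0` in `Ω(u)`
    (hψpde : ∀ p ∈ plateRegion D u,
      ε ^ 2 * (pdir2 ((1, 0), 0) ψ p + pdir2 ((0, 1), 0) ψ p)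
        + pdir2 ((0, 0), 1) ψ p = 0)
    -- the boundary condition on `∂Ω(u)`
    (hψbc : ∀ p ∈ frontier (plateRegion D u),
      ψ p = (1 + p.2) / (1 + u p.1)) :
    (∀ p ∈ plateRegion D u, ψ p ≤ 1 + p.2 - u p.1) ∧
    (∀ x ∈ D, ∀ d : ℝ,
      HasDerivWithinAt (fun z => ψ (x, z)) d (Set.Ioc (-1) (u x)) (u x) →
        1 ≤ d) := by
  have hopen : IsOpen (plateRegion D u) :=
    isOpen_plateRegion hDopen (hucont.mono subset_closure)
  have hfront : ∀ p ∈ frontier (plateRegion D u), ψ p ≤ 1 + p.2 - u p.1 := by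
    intro p hp
    rw [hψbc p hp]
    by_cases hpD : p.1 ∈ D
    · obtain ⟨hlow, hup⟩ := bounds_of_mem_closure_plateRegion hucont hp.1
      obtain ⟨hu₁, hu₂⟩ := hurange _ hpD
      have hnot : p ∉ plateRegion D u := fun h => hp.2 (hopen.interior_eq.symm ▸ h)
      rw [div_le_iff₀ (by linarith)]
      rcases hlow.eq_or_lt with h | h
      · rw [← h]
        nlinarith
      · have : p.2 = u p.1 := hup.antisymm (not_lt.1 fun h' => hnot ⟨hpD, h, h'⟩)
        rw [this]
        linarith
    · have : u p.1 = 0 := hubc _ ⟨fst_mem_closure_of_mem_closure_plateRegion hp.1,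
        fun h => hpD (interior_subset h)⟩
      simp [this]
  have hcmp : ∀ p ∈ plateRegion D u, ψ p ≤ 1 + p.2 - u p.1 := by
    intro p₀ hp₀
    by_contra! hlt
    obtain ⟨δ, hδ, hδp₀⟩ : ∃ δ > 0, δ < ψ p₀ - (1 + p₀.2 - u p₀.1) :=
      exists_between (sub_pos.2 hlt)
    set w : (ℝ × ℝ) × ℝ → ℝ := fun p => ψ p - (1 + p.2 - u p.1) + δ * p.2 ^ 2 with hw
    have hu_cl : ContinuousOn (fun p : (ℝ × ℝ) × ℝ => u p.1) (closure (plateRegion D u)) :=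
      hucont.comp continuousOn_fst fun _ h => fst_mem_closure_of_mem_closure_plateRegion h
    have hwcont : ContinuousOn w (closure (plateRegion D u)) :=
      (hψcont.sub ((by fun_prop : ContinuousOn (fun p : (ℝ × ℝ) × ℝ => 1 + p.2) _).sub hu_cl)).add
        (by fun_prop)
    obtain ⟨q, hq, hqmax⟩ :=
      (isBounded_plateRegion hDbdd fun x hx => (hurange x hx).2).isCompact_closure.exists_isMaxOn
        ⟨p₀, subset_closure hp₀⟩ hwcont
    have hw₀ : δ < w p₀ := by
      have : 0 ≤ δ * p₀.2 ^ 2 := by positivity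
      simp only [hw]
      linarith
    have hqΩ : q ∈ plateRegion D u := by
      by_contra hqn
      have hqf : q ∈ frontier (plateRegion D u) := ⟨hq, fun h => hqn (interior_subset h)⟩
      obtain ⟨hlow, hup⟩ := bounds_of_mem_closure_plateRegion hucont hq
      have hu₀ : u q.1 ≤ 0 := by
        by_cases hqD : q.1 ∈ D
        · exact (hurange _ hqD).2
        · exact (hubc _ ⟨fst_mem_closure_of_mem_closure_plateRegion hq,
            fun h => hqD (interior_subset h)⟩).le
      have hsq : q.2 ^ 2 ≤ 1 := by nlinarith
      have hwq : w q ≤ δ := by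
        have h₁ := hfront q hqf
        have h₂ : δ * q.2 ^ 2 ≤ δ := mul_le_of_le_one_right hδ.le hsq
        simp only [hw]
        linarith
      exact absurd (hqmax (subset_closure hp₀)) (not_le.2 (hwq.trans_lt hw₀))
    have hloc : IsLocalMax w q :=
      (hqmax.on_subset subset_closure).isLocalMax (hopen.mem_nhds hqΩ)
    have hψ : ∀ᶠ p in 𝓝 q, DifferentiableAt ℝ ψ p :=
      eventually_of_mem (hopen.mem_nhds hqΩ) hψdiff
    have hu : ∀ᶠ x in 𝓝 q.1, DifferentiableAt ℝ u x :=
      eventually_of_mem (hDopen.mem_nhds hqΩ.1) hudiff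
    have h₁ := pdir2_add_le_of_isLocalMax (e := ((1, 0), 0)) hloc hψ
      (hψdiff2 _ q hqΩ) hu (hudiff1 _ hqΩ.1)
    have h₂ := pdir2_add_le_of_isLocalMax (e := ((0, 1), 0)) hloc hψ
      (hψdiff2 _ q hqΩ) hu (hudiff2 _ hqΩ.1)
    have h₃ := pdir2_add_le_of_isLocalMax (e := (0, 1)) hloc hψ
      (hψdiff2 _ q hqΩ) hu (by simp)
    simp only [map_zero, one_pow, mul_one] at h₃
    have hpde : ε ^ 2 * (pdir2 ((1, 0), 0) ψ q + pdir2 ((0, 1), 0) ψ q)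
        + pdir2 (0, 1) ψ q = 0 := hψpde q hqΩ
    have hlap := hulap _ hqΩ.1
    have hsum : pdir2 ((1, 0), 0) ψ q + pdir2 ((0, 1), 0) ψ q ≤ 0 := by
      norm_num at h₁ h₂
      linarith
    have := mul_nonpos_of_nonneg_of_nonpos (sq_nonneg ε) hsum
    linarith
  refine ⟨hcmp, fun x hx d hd => ?_⟩
  have hux := (hurange x hx).1
  have htop : ψ (x, u x) = 1 := by
    rw [hψbc _ (mk_mem_frontier_plateRegion hx hux)]
    exact div_self (by linarith)
  rw [hasDerivWithinAt_iff_tendsto_slope, Ioc_sdiff_right] at hd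
  have := right_nhdsWithin_Ioo_neBot hux
  refine ge_of_tendsto hd (eventually_of_mem self_mem_nhdsWithin fun z hz => ?_)
  have hle := hcmp (x, z) ⟨hx, hz⟩
  have hz' : z - u x < 0 := sub_neg.2 hz.2
  rw [slope_def_field, htop, le_div_iff_of_neg hz']
  simp only at hle
  linarith
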